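/- Fix a monomial order ≺ on ℕ^p whose initial segments are finite. Let p ≥ 2, let λ₁, λ₂ ≥ 2 be coprime integers, let T = ⟨λ₁, λ₂⟩ be the numerical semigroup generated by λ₁ and λ₂, let j ∈ {1, …, p}, let q_i ∈ ℕ for i ∈ {1, …, p} \ {j}, and let S = ℕ^p \ {x ∈ ℕ^p : x_j ∉ T and x_i < q_i for all i ≠ j}. Then S is an ℕ^p-semigroup satisfying the extended Wilf conjecture: n(S)·e(S) ≥ N(Fb(S)) + 1. -/

import Mathlib

/-- `S ⊆ ℕ^p` contains `0` and is closed under addition. -/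
def IsSubmonoidSet {p : ℕ} (S : Set (Fin p → ℕ)) : Prop :=
  (0 : Fin p → ℕ) ∈ S ∧ ∀ x ∈ S, ∀ y ∈ S, x + y ∈ S

/-- `s` is a minimal generator of `S`: it is a nonzero element of `S` that is not a
sum of two nonzero elements of `S`. -/
def IsMinGen {p : ℕ} (S : Set (Fin p → ℕ)) (s : Fin p → ℕ) : Prop :=
  s ∈ S ∧ s ≠ 0 ∧ ∀ a ∈ S, ∀ b ∈ S, a ≠ 0 → b ≠ 0 → a + b ≠ s

/-- The (unique) minimal generating set of `S`. -/
def minGens {p : ℕ} (S : Set (Fin p → ℕ)) : Set (Fin p → ℕ) :=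
  {s | IsMinGen S s}

/-- `prec` is (the strict part of) a monomial order on `ℕ^p` all of whose initial
segments are finite. -/
def IsMonomialOrder {p : ℕ} (prec : (Fin p → ℕ) → (Fin p → ℕ) → Prop) : Prop :=
  (∀ a, ¬ prec a a) ∧
  (∀ a b c, prec a b → prec b c → prec a c) ∧
  (∀ a b, a ≠ b → prec a b ∨ prec b a) ∧
  (∀ a b c, prec a b → prec (a + c) (b + c)) ∧
  (∀ c, c ≠ (0 : Fin p → ℕ) → prec 0 c) ∧
  (∀ a, {b | prec b a}.Finite)

/-- The semigroup $ℕ^p \setminus \{x \mid x_j ∉ ⟨λ_1,λ_2⟩ \text{ and } x_i < q_i\ ∀ i ≠ j\}$. -/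
def S15 (p l1 l2 : ℕ) (j : Fin p) (q : Fin p → ℕ) : Set (Fin p → ℕ) :=
  {x | ¬ (x j ∉ AddSubmonoid.closure ({l1, l2} : Set ℕ) ∧ ∀ i : Fin p, i ≠ j → x i < q i)}

/-- The elements of the numerical semigroup `⟨m, n⟩` are the combinations `u * m + v * n`. -/
theorem mem_closure_natPair {m n t : ℕ} :
    t ∈ AddSubmonoid.closure ({m, n} : Set ℕ) ↔ ∃ u v : ℕ, u * m + v * n = t := by
  simp [AddSubmonoid.mem_closure_pair]

/-- Two-generated numerical semigroups are symmetric: reflecting a gap in the Frobenius number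
gives an element of the semigroup. -/
theorem frobenius_sub_mem_closure_pair {m n t : ℕ} (hn : 0 < n) (hcop : m.Coprime n)
    (ht : t ∉ AddSubmonoid.closure ({m, n} : Set ℕ)) :
    m * n - m - n - t ∈ AddSubmonoid.closure ({m, n} : Set ℕ) := by
  obtain ⟨u, hu, hmod⟩ := Nat.exists_mul_mod_eq_of_coprime t hcop hn.ne'
  have hw : u * m ≡ t [MOD n] := by
    rw [mul_comm]
    exact hmod
  rw [mem_closure_natPair] at ht ⊢
  have hlt : t < u * m := by
    by_contra! hle
    obtain ⟨v, hv⟩ := (Nat.modEq_iff_dvd' hle).mp hw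
    exact ht ⟨u, v, by rw [mul_comm v]; omega⟩
  obtain ⟨v, hv⟩ := (Nat.modEq_iff_dvd' hlt.le).mp hw.symm
  obtain ⟨k, rfl⟩ : ∃ k, n = u + 1 + k := ⟨n - (u + 1), by omega⟩
  obtain ⟨l, rfl⟩ : ∃ l, v = l + 1 := by
    refine ⟨v - 1, ?_⟩
    rcases v with _ | v
    · omega
    · rfl
  refine ⟨k, l, ?_⟩
  have hum : u * m = t + (u + 1 + k) * (l + 1) := by omega
  have hmn : m * (u + 1 + k) = u * m + m + k * m := by ring
  have hnl : (u + 1 + k) * (l + 1) = l * (u + 1 + k) + (u + 1 + k) := by ring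
  omega

/-- A generator of a two-generated numerical semigroup is not a sum of two nonzero elements. -/
theorem add_ne_left_of_mem_closure_pair {m n a b : ℕ} (hn : 2 ≤ n) (hcop : m.Coprime n)
    (ha : a ∈ AddSubmonoid.closure ({m, n} : Set ℕ))
    (hb : b ∈ AddSubmonoid.closure ({m, n} : Set ℕ)) (ha0 : a ≠ 0) (hb0 : b ≠ 0) :
    a + b ≠ m := by
  rw [mem_closure_natPair] at ha hb
  obtain ⟨u, v, rfl⟩ := ha
  obtain ⟨u', v', rfl⟩ := hb
  intro h
  rcases Nat.eq_zero_or_pos u with rfl | hu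
  · rcases Nat.eq_zero_or_pos u' with rfl | hu'
    · have hdvd : n ∣ m := ⟨v + v', by rw [← h]; ring⟩
      have := Nat.Coprime.eq_one_of_dvd hcop.symm hdvd
      omega
    · have := Nat.le_mul_of_pos_left m hu'
      omega
  · have := Nat.le_mul_of_pos_left m hu
    omega

/-- A monomial order refines the componentwise order. -/
theorem IsMonomialOrder.of_le_of_ne {p : ℕ} {prec : (Fin p → ℕ) → (Fin p → ℕ) → Prop}
    (h : IsMonomialOrder prec) {a b : Fin p → ℕ} (hle : a ≤ b) (hne : a ≠ b) : prec a b := by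
  obtain ⟨c, rfl⟩ := exists_add_of_le hle
  have hc : c ≠ 0 := by
    rintro rfl
    simp at hne
  have := h.2.2.2.1 0 c a (h.2.2.2.2.1 c hc)
  rwa [zero_add, add_comm] at this

/-- If all coordinates of all gaps of `S` are below `B`, then all coordinates of the minimal
generators are below `2 * B`. -/
theorem IsMinGen.lt_two_mul {p : ℕ} {S : Set (Fin p → ℕ)} {B : ℕ} (hB : 0 < B)
    (hS : ∀ x, x ∉ S → ∀ i, x i < B) {s : Fin p → ℕ} (hs : IsMinGen S s) (i : Fin p) :
    s i < 2 * B := by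
  by_contra! hle
  have mem : ∀ x : Fin p → ℕ, B ≤ x i → x ∈ S := fun x hx => by
    by_contra hxS
    exact absurd (hS x hxS i) (by omega)
  have ne : ∀ x : Fin p → ℕ, B ≤ x i → x ≠ 0 := by
    rintro x hx rfl
    simp at hx
    omega
  have ha : B ≤ (Pi.single i B : Fin p → ℕ) i := by simp
  have hb : B ≤ (s - (Pi.single i B : Fin p → ℕ)) i := by simp; omega
  refine hs.2.2 _ (mem _ ha) _ (mem _ hb) (ne _ ha) (ne _ hb) (add_tsub_cancel_of_le ?_)
  intro k
  rcases eq_or_ne k i with rfl | hk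
  · simp; omega
  · simp [hk]

theorem finite_of_forall_lt {p : ℕ} {A : Set (Fin p → ℕ)} {B : ℕ}
    (hA : ∀ x ∈ A, ∀ i, x i < B) : A.Finite :=
  (Set.finite_Icc (0 : Fin p → ℕ) fun _ => B).subset fun x hx =>
    ⟨fun _ => Nat.zero_le _, fun i => (hA x hx i).le⟩

section S15

variable {p l1 l2 : ℕ} {j : Fin p} {q : Fin p → ℕ}

theorem notMem_S15 {x : Fin p → ℕ} :
    x ∉ S15 p l1 l2 j q ↔
      x j ∉ AddSubmonoid.closure ({l1, l2} : Set ℕ) ∧ ∀ i, i ≠ j → x i < q i :=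
  not_not

theorem mem_S15_of_mem {x : Fin p → ℕ}
    (hx : x j ∈ AddSubmonoid.closure ({l1, l2} : Set ℕ)) : x ∈ S15 p l1 l2 j q :=
  fun h => h.1 hx

theorem isSubmonoidSet_S15 : IsSubmonoidSet (S15 p l1 l2 j q) := by
  refine ⟨mem_S15_of_mem (zero_mem _), fun x hx y hy => ?_⟩
  by_contra hxy
  rw [notMem_S15] at hxy
  have mem : ∀ z ∈ S15 p l1 l2 j q, z ≤ x + y →
      z j ∈ AddSubmonoid.closure ({l1, l2} : Set ℕ) := fun z hz hle => by
    by_contra hzj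
    exact hz ⟨hzj, fun i hi => (hle i).trans_lt (hxy.2 i hi)⟩
  exact hxy.1 (add_mem (mem x hx le_self_add) (mem y hy le_add_self))

theorem lt_of_notMem_S15 (hl1 : 2 ≤ l1) (hl2 : 2 ≤ l2) (hcop : l1.Coprime l2)
    {x : Fin p → ℕ} (hx : x ∉ S15 p l1 l2 j q) (i : Fin p) : x i < l1 * l2 + ∑ k, q k := by
  rw [notMem_S15] at hx
  rcases eq_or_ne i j with rfl | hi
  · have h1 : x i ≤ l1 * l2 - l1 - l2 :=
      (frobeniusNumber_pair hcop (by omega) (by omega)).2 hx.1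
    have h2 : 0 < l1 * l2 := by positivity
    omega
  · have h1 := hx.2 i hi
    have h2 : q i ≤ ∑ k, q k := Finset.single_le_sum (fun _ _ => Nat.zero_le _) (Finset.mem_univ i)
    omega

/-- The generators of `⟨l1, l2⟩` on the `j`-th axis are minimal generators. -/
theorem isMinGen_S15_single_left (hl1 : 2 ≤ l1) (hl2 : 2 ≤ l2) (hcop : l1.Coprime l2)
    (hq : ∀ i, i ≠ j → 0 < q i) : IsMinGen (S15 p l1 l2 j q) (Pi.single j l1) := by
  refine ⟨mem_S15_of_mem ?_, by simp; omega, fun a ha b hb ha0 hb0 hab => ?_⟩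
  · rw [Pi.single_eq_same]
    exact AddSubmonoid.subset_closure (by simp)
  have axis : ∀ c ∈ S15 p l1 l2 j q, c ≠ 0 → c ≤ Pi.single j l1 →
      c j ∈ AddSubmonoid.closure ({l1, l2} : Set ℕ) ∧ c j ≠ 0 := fun c hc hc0 hle => by
    have hci : ∀ i, i ≠ j → c i = 0 := fun i hi => by simpa [hi] using hle i
    refine ⟨?_, fun hcj => hc0 <| funext fun i => ?_⟩
    · by_contra hcj
      exact hc ⟨hcj, fun i hi => by rw [hci i hi]; exact hq i hi⟩
    · rcases eq_or_ne i j with rfl | hi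
      exacts [hcj, hci i hi]
  obtain ⟨haj, haj0⟩ := axis a ha ha0 (hab ▸ le_self_add)
  obtain ⟨hbj, hbj0⟩ := axis b hb hb0 (hab ▸ le_add_self)
  refine add_ne_left_of_mem_closure_pair hl2 hcop haj hbj haj0 hbj0 ?_
  simpa using congrFun hab j

theorem S15_comm : S15 p l1 l2 j q = S15 p l2 l1 j q := by
  unfold S15
  rw [Set.pair_comm]

theorem isMinGen_S15_single_one {i : Fin p} (hi : i ≠ j) :
    IsMinGen (S15 p l1 l2 j q) (Pi.single i 1) := by
  refine ⟨mem_S15_of_mem ?_, by simp, fun a _ b _ ha0 hb0 hab => ?_⟩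
  · rw [Pi.single_eq_of_ne hi.symm]
    exact zero_mem _
  have axis : ∀ c : Fin p → ℕ, c ≠ 0 → c ≤ Pi.single i 1 → c i ≠ 0 := fun c hc0 hle hci =>
    hc0 <| funext fun k => by
      rcases eq_or_ne k i with rfl | hk
      · exact hci
      · simpa [hk] using hle k
  have ha := axis a ha0 (hab ▸ le_self_add)
  have hb := axis b hb0 (hab ▸ le_add_self)
  have : a i + b i = 1 := by simpa using congrFun hab i
  omega

theorem finite_minGens_S15 (hl1 : 2 ≤ l1) (hl2 : 2 ≤ l2) (hcop : l1.Coprime l2) :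
    (minGens (S15 p l1 l2 j q)).Finite :=
  finite_of_forall_lt fun _ hs i =>
    IsMinGen.lt_two_mul (by positivity) (fun _ hx => lt_of_notMem_S15 hl1 hl2 hcop hx) hs i

theorem three_le_ncard_minGens_S15 (hp : 2 ≤ p) (hl1 : 2 ≤ l1) (hl2 : 2 ≤ l2)
    (hcop : l1.Coprime l2) (hq : ∀ i, i ≠ j → 0 < q i) :
    3 ≤ (minGens (S15 p l1 l2 j q)).ncard := by
  have : Nontrivial (Fin p) := Fin.nontrivial_iff_two_le.mpr hp
  obtain ⟨i, hi⟩ := exists_ne j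
  have hne : l1 ≠ l2 := by
    rintro rfl
    rw [Nat.coprime_self] at hcop
    omega
  have hsub : ({Pi.single j l1, Pi.single j l2, Pi.single i 1} : Set (Fin p → ℕ)) ⊆
      minGens (S15 p l1 l2 j q) := by
    rintro s (rfl | rfl | rfl)
    · exact isMinGen_S15_single_left hl1 hl2 hcop hq
    · rw [S15_comm]
      exact isMinGen_S15_single_left hl2 hl1 hcop.symm hq
    · exact isMinGen_S15_single_one hi
  have off : ∀ l, (Pi.single j l : Fin p → ℕ) ≠ Pi.single i 1 := fun l h => by
    simpa [hi] using congrFun h i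
  have hcard : ({Pi.single j l1, Pi.single j l2, Pi.single i 1} : Set (Fin p → ℕ)).ncard = 3 :=
    Set.ncard_eq_three.mpr
      ⟨_, _, _, fun h => hne (Pi.single_injective j h), off l1, off l2, rfl⟩
  exact hcard ▸ Set.ncard_le_ncard hsub (finite_minGens_S15 hl1 hl2 hcop)

/-- Reflecting the `j`-th coordinate maps the gaps injectively to elements below the Frobenius
element. -/
theorem ncard_gaps_S15_le {prec : (Fin p → ℕ) → (Fin p → ℕ) → Prop}
    (hprec : IsMonomialOrder prec) (hl1 : 2 ≤ l1) (hl2 : 2 ≤ l2) (hcop : l1.Coprime l2)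
    (hq : ∀ i, i ≠ j → 0 < q i) {Fb : Fin p → ℕ}
    (hFb : ∀ x, x ∉ S15 p l1 l2 j q → x ≠ Fb → prec x Fb) :
    {x | x ∉ S15 p l1 l2 j q}.ncard ≤ {x | x ∈ S15 p l1 l2 j q ∧ prec x Fb}.ncard := by
  have hF := frobeniusNumber_pair hcop (by omega) (by omega)
  refine Set.ncard_le_ncard_of_injOn
    (fun x => Function.update x j (l1 * l2 - l1 - l2 - x j)) (fun x hx => ?_)
    (fun x hx y hy hxy => ?_) ((hprec.2.2.2.2.2 Fb).subset fun x hx => hx.2)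
  · have hx' := notMem_S15.mp hx
    have hmem : Function.update x j (l1 * l2 - l1 - l2 - x j) ∈ S15 p l1 l2 j q :=
      mem_S15_of_mem (by
        rw [Function.update_self]
        exact frobenius_sub_mem_closure_pair (by omega) hcop hx'.1)
    set top : Fin p → ℕ := Function.update (fun i => q i - 1) j (l1 * l2 - l1 - l2) with htop
    have htopS : top ∉ S15 p l1 l2 j q := notMem_S15.mpr ⟨by simpa [htop] using hF.1,
      fun i hi => by
        have := hq i hi
        simp [htop, hi]
        omega⟩
    have hle : Function.update x j (l1 * l2 - l1 - l2 - x j) ≤ top := fun i => by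
      rcases eq_or_ne i j with rfl | hi
      · simp [htop]
      · have := hx'.2 i hi
        simp [htop, hi]
        omega
    have hlt := hprec.of_le_of_ne hle fun h => htopS (h ▸ hmem)
    refine ⟨hmem, ?_⟩
    rcases eq_or_ne top Fb with h | h
    · exact h ▸ hlt
    · exact hprec.2.1 _ _ _ hlt (hFb top htopS h)
  · have hxF : x j ≤ l1 * l2 - l1 - l2 := hF.2 (notMem_S15.mp hx).1
    have hyF : y j ≤ l1 * l2 - l1 - l2 := hF.2 (notMem_S15.mp hy).1
    funext i
    have hi := congrFun hxy i
    rcases eq_or_ne i j with rfl | hij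
    · simp only [Function.update_self] at hi
      omega
    · simpa [hij] using hi

end S15

theorem stmt16 {p : ℕ} (hp : 2 ≤ p)
    (prec : (Fin p → ℕ) → (Fin p → ℕ) → Prop) (hprec : IsMonomialOrder prec)
    (l1 l2 : ℕ) (hl1 : 2 ≤ l1) (hl2 : 2 ≤ l2) (hcop : Nat.gcd l1 l2 = 1)
    (j : Fin p) (q : Fin p → ℕ)
    (Fb : Fin p → ℕ)
    (hFb : Fb ∉ S15 p l1 l2 j q ∧
      ∀ x : Fin p → ℕ, x ∉ S15 p l1 l2 j q → x ≠ Fb → prec x Fb) :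
    IsSubmonoidSet (S15 p l1 l2 j q) ∧
    {x : Fin p → ℕ | x ∉ S15 p l1 l2 j q}.Finite ∧
    {x : Fin p → ℕ | x ∈ S15 p l1 l2 j q ∧ prec x Fb}.ncard
        + {x : Fin p → ℕ | x ∉ S15 p l1 l2 j q}.ncard + 1
      ≤ {x : Fin p → ℕ | x ∈ S15 p l1 l2 j q ∧ prec x Fb}.ncard
        * (minGens (S15 p l1 l2 j q)).ncard := by
  have hcop : l1.Coprime l2 := hcop
  have hgaps : {x : Fin p → ℕ | x ∉ S15 p l1 l2 j q}.Finite :=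
    finite_of_forall_lt fun x hx => lt_of_notMem_S15 hl1 hl2 hcop hx
  refine ⟨isSubmonoidSet_S15, hgaps, ?_⟩
  have hq : ∀ i, i ≠ j → 0 < q i := fun i hi =>
    (Nat.zero_le _).trans_lt ((notMem_S15.mp hFb.1).2 i hi)
  have hpos : 0 < {x : Fin p → ℕ | x ∉ S15 p l1 l2 j q}.ncard :=
    (Set.ncard_pos hgaps).mpr ⟨Fb, hFb.1⟩
  have hle := ncard_gaps_S15_le hprec hl1 hl2 hcop hq hFb.2
  have hmul := Nat.mul_le_mul_left {x : Fin p → ℕ | x ∈ S15 p l1 l2 j q ∧ prec x Fb}.ncard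
    (three_le_ncard_minGens_S15 hp hl1 hl2 hcop hq)
  omega
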